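/- arXiv:0905.1343 — 2 statements merged into one kernel-verified Lean document; each statement's English description precedes it below -/
import Mathlib

section
/- For all real numbers λ with 0 < λ, the integral ∫₀^∞ sin(λu)/(e^{2πu} - 1) du equals 1/4 + (1/2)(1/(e^λ - 1) - 1/λ). -/
open Real MeasureTheory

lemma aux_int (lam a : ℝ) (ha : 0 < a) :
    IntegrableOn (fun u : ℝ => Real.sin (lam * u) * Real.exp (-a * u)) (Set.Ioi 0) ∧
    ∫ u in Set.Ioi (0:ℝ), Real.sin (lam * u) * Real.exp (-a * u) = lam / (a ^ 2 + lam ^ 2) := by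
  have hre : ((-a + lam * Complex.I : ℂ)).re < 0 := by simpa using ha
  have h1 := integrableOn_exp_mul_complex_Ioi hre 0
  have h2 := integral_exp_mul_complex_Ioi hre 0
  have h3 : (fun u : ℝ => Real.sin (lam * u) * Real.exp (-a * u)) =
      fun u : ℝ => RCLike.im (Complex.exp ((-a + lam * Complex.I) * u)) := by
    funext u
    simp [Complex.exp_im, mul_comm]
  rw [h3]
  refine ⟨h1.im, ?_⟩
  rw [integral_im h1, h2]
  simp [Complex.div_im, Complex.normSq_apply]
  ring

lemma aux_x (a : ℝ) (ha : 0 < a) :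
    IntegrableOn (fun u : ℝ => u * Real.exp (-a * u)) (Set.Ioi 0) ∧
    ∫ u in Set.Ioi (0:ℝ), u * Real.exp (-a * u) = 1 / a ^ 2 := by
  constructor
  · have := integrableOn_rpow_mul_exp_neg_mul_rpow (p := 1) (s := 1) (b := a)
      (by norm_num) one_pos ha
    simpa using this
  · have := Real.integral_rpow_mul_exp_neg_mul_Ioi (a := 2) (r := a) (by norm_num) ha
    norm_num at this
    simpa using this

lemma aux_sum (lam : ℝ) (hlam : 0 < lam) :
    ∑' n : ℕ, lam / ((2 * π * (n + 1)) ^ 2 + lam ^ 2) =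
      1/4 + (1/2) * (1 / (Real.exp lam - 1) - 1 / lam) := by
  have hpi := Real.pi_pos
  have hpc : (π : ℂ) ≠ 0 := by exact_mod_cast hpi.ne'
  have hlc : (lam : ℂ) ≠ 0 := by exact_mod_cast hlam.ne'
  set x : ℂ := Complex.I * (lam / (2 * π) : ℝ) with hx
  have him : 0 < x.im := by
    rw [hx, Complex.I_mul_im, Complex.ofReal_re]; positivity
  have hmem : x ∈ Complex.integerComplement :=
    UpperHalfPlane.coe_mem_integerComplement ⟨x, him⟩
  have h := cot_series_rep' hmem
  have ht : ∀ n : ℕ, (1 / (x - (n + 1)) + 1 / (x + (n + 1))) =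
      (-4 * π * Complex.I) * ((lam / ((2 * π * (n + 1)) ^ 2 + lam ^ 2) : ℝ) : ℂ) := by
    intro n
    have e := cotTerm_identity hmem n
    simp only [cotTerm] at e
    rw [e]
    have hd : (((2 * π * (n + 1)) ^ 2 + lam ^ 2 : ℝ) : ℂ) ≠ 0 := by
      norm_cast; positivity
    have hk : (x + (n + 1)) * (x - (n + 1)) =
        -(((2 * π * (n + 1)) ^ 2 + lam ^ 2 : ℝ) : ℂ) / (4 * π ^ 2) := by
      rw [hx]; push_cast; field_simp; ring_nf; rw [Complex.I_sq]; ring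
    rw [hk, Complex.ofReal_div, hx]
    generalize (((2 * π * (n + 1)) ^ 2 + lam ^ 2 : ℝ) : ℂ) = D at hd
    push_cast
    field_simp
  rw [tsum_congr ht, tsum_mul_left, ← Complex.ofReal_tsum] at h
  have hexp : Complex.exp (2 * π * Complex.I * x) = ((Real.exp lam)⁻¹ : ℝ) := by
    rw [← Real.exp_neg, Complex.ofReal_exp]
    congr 1
    rw [hx]; push_cast; field_simp; rw [Complex.I_sq]
  have hE : (1:ℝ) < Real.exp lam := by simpa using hlam
  rw [Complex.cot_pi_eq_exp_ratio, hexp] at h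
  generalize Real.exp lam = E at h hE ⊢
  generalize (∑' n : ℕ, lam / ((2 * π * ((n:ℝ) + 1)) ^ 2 + lam ^ 2)) = S at h ⊢
  have hE1 : (E : ℂ) - 1 ≠ 0 := by
    rw [sub_ne_zero]; exact_mod_cast hE.ne'
  have hE0 : (E : ℂ) ≠ 0 := by
    have : E ≠ 0 := by linarith
    exact_mod_cast this
  have h5 : (1 - ((E⁻¹ : ℝ) : ℂ)) = (E - 1) / E := by push_cast; field_simp
  rw [h5, hx] at h
  apply Complex.ofReal_injective
  push_cast at h ⊢
  field_simp at h ⊢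
  rw [Complex.I_sq] at h
  linear_combination (-2) * h

theorem stmt_0 (lam : ℝ) (hlam : 0 < lam) :
    ∫ u in Set.Ioi (0:ℝ), Real.sin (lam * u) / (Real.exp (2 * π * u) - 1) =
      1/4 + (1/2) * (1 / (Real.exp lam - 1) - 1 / lam) := by
  have hpi := Real.pi_pos
  have ha : ∀ n : ℕ, 0 < 2 * π * ((n:ℝ) + 1) := fun n => by positivity
  have key := hasSum_integral_of_summable_integral_norm (μ := volume.restrict (Set.Ioi (0:ℝ)))
    (F := fun (n : ℕ) (u : ℝ) => Real.sin (lam * u) * Real.exp (-(2 * π * ((n:ℝ) + 1)) * u))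
    (fun n => (aux_int lam _ (ha n)).1) (by
      have hs : Summable (fun n : ℕ => (lam / (2 * π) ^ 2) * (1 / ((n:ℝ) + 1) ^ 2)) := by
        apply Summable.mul_left
        have := (summable_nat_add_iff 1).2 (Real.summable_one_div_nat_pow.2 (one_lt_two))
        simpa using this
      refine Summable.of_nonneg_of_le (fun n => integral_nonneg fun u => norm_nonneg _)
        (fun n => ?_) hs
      have hx := aux_x _ (ha n)
      calc _ ≤ ∫ u in Set.Ioi (0:ℝ), lam * (u * Real.exp (-(2 * π * ((n:ℝ) + 1)) * u)) := by
            refine setIntegral_mono_on (aux_int lam _ (ha n)).1.norm (hx.1.const_mul lam)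
              measurableSet_Ioi ?_
            intro u hu
            have hu : 0 < u := hu
            rw [norm_mul, Real.norm_eq_abs, Real.norm_eq_abs, Real.abs_exp, ← mul_assoc]
            gcongr
            have := Real.abs_sin_le_abs (x := lam * u)
            rwa [abs_of_pos (by positivity : 0 < lam * u)] at this
        _ = _ := by
            rw [integral_const_mul, hx.2]
            field_simp)
  rw [← aux_sum lam hlam, ← tsum_congr (fun n => (aux_int lam _ (ha n)).2), key.tsum_eq]
  refine setIntegral_congr_fun measurableSet_Ioi ?_
  intro u hu
  have hu : 0 < u := hu
  have hlt : Real.exp (-(2 * π * u)) < 1 := by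
    rw [Real.exp_lt_one_iff]; simp; positivity
  have hg := (hasSum_geometric_of_lt_one (Real.exp_pos _).le hlt).mul_left
    (Real.sin (lam * u) * Real.exp (-(2 * π * u)))
  have e : ∀ n : ℕ, Real.sin (lam * u) * Real.exp (-(2 * π * ((n:ℝ) + 1)) * u) =
      Real.sin (lam * u) * Real.exp (-(2 * π * u)) * Real.exp (-(2 * π * u)) ^ n := by
    intro n
    rw [← Real.exp_nat_mul, mul_assoc (Real.sin (lam * u)), ← Real.exp_add]
    ring_nf
  simp only [e]
  rw [hg.tsum_eq, Real.exp_neg]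
  have h1 : 1 < Real.exp (2 * π * u) := by
    rw [Real.one_lt_exp_iff]; positivity
  have h2 : Real.exp (2 * π * u) - 1 ≠ 0 := by linarith
  have h3 : 1 - (Real.exp (2 * π * u))⁻¹ = (Real.exp (2 * π * u) - 1) / Real.exp (2 * π * u) := by
    field_simp
  rw [h3]
  field_simp
end

section
/- Let q = e^{-2πα} with α > 0 and let τ* = i/α, q* = e^{2πiτ*} = e^{-2π/α}. Then the Dedekind eta modular relation holds: (q;q)_∞ = q^{-1/24} · α^{-1/2} · (q*)^{1/24} · (q*;q*)_∞, where (a;b)_∞ = Π_{n≥0}(1 - a b^n) and all powers are real positive powers. -/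
open Real

lemma eta_imag (t : ℝ) (ht : 0 < t) : ModularForm.eta (t * Complex.I) =
    ((Real.exp (-(2 * π * t) / 24) * ∏' n : ℕ, (1 - Real.exp (-(2 * π * t)) ^ (n + 1)) : ℝ) : ℂ) := by
  have hI : 2 * (π : ℂ) * Complex.I * (t * Complex.I) = -(2 * π * t) := by
    linear_combination 2 * (π : ℂ) * t * Complex.I_mul_I
  have hlt : Real.exp (-(2 * π * t)) < 1 := by
    rw [Real.exp_lt_one_iff]
    have := Real.pi_pos
    have : 0 < 2 * π * t := by positivity
    linarith
  have hm : Multipliable fun n : ℕ => (1 - Real.exp (-(2 * π * t)) ^ (n + 1)) := by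
    apply multipliable_one_add_of_summable (f := fun n : ℕ => -Real.exp (-(2 * π * t)) ^ (n + 1))
    simpa using (summable_nat_add_iff 1).mpr
      (summable_geometric_of_lt_one (Real.exp_pos _).le hlt)
  have hc := hm.map_tprod Complex.ofRealHom Complex.continuous_ofReal
  simp only [Complex.ofRealHom_eq_coe] at hc
  rw [ModularForm.eta, Complex.ofReal_mul, hc]
  simp only [ModularForm.eta_q_eq_pow, Function.Periodic.qParam, hI]
  push_cast
  rfl

theorem stmt_19 (α : ℝ) (hα : 0 < α) :
    ∏' n : ℕ, (1 - Real.exp (-(2 * π * α)) ^ (n + 1)) =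
      Real.exp (-(2 * π * α)) ^ (-(1:ℝ)/24) * α ^ (-(1:ℝ)/2)
        * Real.exp (-(2 * π) / α) ^ ((1:ℝ)/24)
        * ∏' n : ℕ, (1 - Real.exp (-(2 * π) / α) ^ (n + 1)) := by
  have h := ModularForm.eta_comp_eq_csqrt_I_inv (x := (α : ℂ) * Complex.I) (by simpa using hα)
  have hαc : (α : ℂ) ≠ 0 := by exact_mod_cast hα.ne'
  have h1 : -1 / ((α : ℂ) * Complex.I) = ((1 / α : ℝ) : ℂ) * Complex.I := by
    push_cast
    field_simp
    simp
  have h2 : Complex.sqrt ((α : ℂ) * Complex.I) = ((α ^ ((1:ℝ)/2) : ℝ) : ℂ) * Complex.sqrt Complex.I := by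
    rw [Complex.sqrt, Complex.sqrt, Complex.cpow_def_of_ne_zero (mul_ne_zero hαc Complex.I_ne_zero),
      Complex.cpow_def_of_ne_zero Complex.I_ne_zero, Complex.log_ofReal_mul hα Complex.I_ne_zero,
      add_mul, Complex.exp_add, Real.rpow_def_of_pos hα]
    push_cast
    norm_num
  have h3 : Complex.sqrt Complex.I ≠ 0 := by simp [Complex.sqrt]
  simp only [Function.comp, Pi.smul_apply, Pi.mul_apply, smul_eq_mul] at h
  rw [h1, h2, eta_imag _ (by positivity), eta_imag _ hα,
    mul_comm _ (Complex.sqrt Complex.I), mul_assoc (Complex.sqrt Complex.I),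
    inv_mul_cancel_left₀ h3, ← Complex.ofReal_mul, Complex.ofReal_inj] at h
  rw [show -(2 * π * (1 / α)) = -(2 * π) / α by ring] at h
  rw [← Real.exp_mul, ← Real.exp_mul, show -(2 * π) / α * (1/24) = -(2 * π) / α / 24 by ring,
    mul_assoc (_ * _) (Real.exp (-(2 * π) / α / 24)), h, show -(2 * π * α) * (-1 / 24) = -(-(2 * π * α) / 24) by ring, Real.exp_neg (-(2 * π * α) / 24),
    show (-1 / 2 : ℝ) = -(1/2) by ring, Real.rpow_neg hα.le]
  have := (Real.rpow_pos_of_pos hα (1/2)).ne'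
  have h5 := (Real.exp_pos (-(2 * π * α) / 24)).ne'
  generalize Real.exp (-(2 * π * α) / 24) = a at *
  generalize α ^ ((1:ℝ) / 2) = b at *
  generalize ∏' n : ℕ, (1 - Real.exp (-(2 * π * α)) ^ (n + 1)) = c at *
  field_simp
end
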